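/- arXiv:1409.3946 — 2 statements merged into one kernel-verified Lean document; each statement's English description precedes it below -/
import Mathlib

section
/- Let 0 < α < 1, A a real n×n matrix, z⁰ ∈ ℝⁿ, U ⊆ ℝⁿ a nonempty compact set, and t > 0. Then the attainability set Z(t,z⁰) is a convex subset of ℝⁿ (even when U itself is not convex). -/
open scoped Matrix

/-- The matrix α-exponential `e_α^{As} = s^{α−1} Σ_{k=0}^∞ A^k s^{αk} / Γ((k+1)α)`. -/
noncomputable def alphaExp {n : ℕ} (α : ℝ) (A : Matrix (Fin n) (Fin n) ℝ) (s : ℝ) :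
    Matrix (Fin n) (Fin n) ℝ :=
  s ^ (α - 1) • ∑' k : ℕ, (s ^ (α * k) / Real.Gamma ((k + 1) * α)) • A ^ k

/-- The attainability set of the fractional system `D^α z = Az + u`, `J^{1−α}z|_{t=0} = z⁰`:
`Z(t,z⁰) = { e_α^{At} z⁰ + ∫_0^t e_α^{A(t−τ)} u(τ) dτ : u admissible on [0,t] }`,
where an admissible control is a measurable function taking values in `U`. -/
noncomputable def attainSet {n : ℕ} (α : ℝ) (A : Matrix (Fin n) (Fin n) ℝ)
    (z0 : Fin n → ℝ) (U : Set (Fin n → ℝ)) (t : ℝ) : Set (Fin n → ℝ) :=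
  {z | ∃ u : ℝ → Fin n → ℝ, Measurable u ∧ (∀ τ, u τ ∈ U) ∧
    z = (alphaExp α A t).mulVec z0 + ∫ τ in (0 : ℝ)..t, (alphaExp α A (t - τ)).mulVec (u τ)}

open MeasureTheory Set

lemma hilbert_extreme {H : Type*} [NormedAddCommGroup H] [InnerProductSpace ℝ H] [CompleteSpace H]
    {ι : Type*} (v : ι → H) (a b : ι → ℝ) (C : ℝ)
    (hne : ∃ g : H, ∀ i, inner ℝ (v i) g ∈ Icc (a i) (b i))
    (hbd : ∀ g : H, (∀ i, inner ℝ (v i) g ∈ Icc (a i) (b i)) → ‖g‖ ≤ C) :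
    ∃ g : H, (∀ i, inner ℝ (v i) g ∈ Icc (a i) (b i)) ∧
      ∀ h : H, (∀ i, inner ℝ (v i) (g + h) ∈ Icc (a i) (b i)) →
        (∀ i, inner ℝ (v i) (g - h) ∈ Icc (a i) (b i)) → h = 0 := by
  classical
  let T : H → WeakDual ℝ H := fun g => StrongDual.toWeakDual (InnerProductSpace.toDual ℝ H g)
  have hT : ∀ g x, T g x = inner ℝ x g := by
    intro g x
    simp only [T, StrongDual.toWeakDual_apply, InnerProductSpace.toDual_apply_apply]
    exact real_inner_comm _ _
  have hTs : ∀ φ : WeakDual ℝ H, ∃ g, T g = φ := by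
    intro φ
    obtain ⟨g, hg⟩ := (InnerProductSpace.toDual ℝ H).surjective (WeakDual.toStrongDual φ)
    exact ⟨g, by simp [T, hg]⟩
  let K : Set (WeakDual ℝ H) := {φ | ∀ i, φ (v i) ∈ Icc (a i) (b i)}
  have hTK : ∀ g, T g ∈ K ↔ ∀ i, inner ℝ (v i) g ∈ Icc (a i) (b i) := by
    intro g; simp only [K, mem_ofPred_eq, hT]
  have hclosed : IsClosed K := by
    have : K = ⋂ i, (fun φ : WeakDual ℝ H => φ (v i)) ⁻¹' Icc (a i) (b i) := by
      ext; simp [K]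
    rw [this]
    exact isClosed_iInter fun i => isClosed_Icc.preimage (WeakDual.eval_continuous (v i))
  have hcomp : IsCompact K := by
    refine (WeakDual.isCompact_closedBall (𝕜 := ℝ) (E := H) 0 C).of_isClosed_subset hclosed ?_
    intro φ hφ
    obtain ⟨g, rfl⟩ := hTs φ
    have := hbd g ((hTK g).1 hφ)
    simpa [T] using this
  have : LocallyConvexSpace ℝ (WeakDual ℝ H) :=
    inferInstanceAs (LocallyConvexSpace ℝ (WeakBilin (topDualPairing ℝ H)))
  obtain ⟨φ, hφ⟩ := hcomp.extremePoints_nonempty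
    (by obtain ⟨g, hg⟩ := hne; exact ⟨T g, (hTK g).2 hg⟩)
  obtain ⟨g, rfl⟩ := hTs φ
  refine ⟨g, (hTK g).1 hφ.1, fun h h1 h2 => ?_⟩
  have := hφ.2 ((hTK _).2 h1) ((hTK _).2 h2) (by
    refine ⟨1/2, 1/2, by norm_num, by norm_num, by norm_num, ?_⟩
    refine DFunLike.ext _ _ fun x => ?_
    have : ∀ (c : ℝ) (φ ψ : WeakDual ℝ H), (c • φ + c • ψ) x = c * φ x + c * ψ x := fun _ _ _ => rfl
    rw [this, hT, hT, hT, inner_add_right, inner_sub_right]; ring)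
  have h3 : inner ℝ h (g + h) = inner ℝ h g := by rw [← hT, ← hT, this]
  rw [inner_add_right] at h3
  have : inner ℝ h h = 0 := by linarith
  exact inner_self_eq_zero.1 this

open Polynomial in
lemma exists_poly {n : ℕ} (c : Fin (n + 1) → Fin n → ℝ) :
    ∃ a : Fin (n + 1) → ℝ, a ≠ 0 ∧ ∀ i, ∑ k, a k * c k i = 0 := by
  let L : (Fin (n + 1) → ℝ) →ₗ[ℝ] (Fin n → ℝ) := Fintype.linearCombination ℝ c
  have h : LinearMap.ker L ≠ ⊥ := LinearMap.ker_ne_bot_of_finrank_lt (by simp)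
  obtain ⟨a, ha, h0⟩ := (Submodule.ne_bot_iff _).1 h
  refine ⟨a, h0, fun i => ?_⟩
  have := congrFun (LinearMap.mem_ker.1 ha) i
  simpa [L, Fintype.linearCombination_apply] using this

lemma poly_null (μ : Measure ℝ) [NullSingletonClass μ] {n : ℕ} (a : Fin n → ℝ) (ha : a ≠ 0) :
    ∀ᵐ x ∂μ, ∑ k, a k * x ^ (k : ℕ) ≠ 0 := by
  classical
  let p : Polynomial ℝ := ∑ k : Fin n, Polynomial.monomial (k : ℕ) (a k)
  have hp : p ≠ 0 := by
    obtain ⟨k, hk⟩ := Function.ne_iff.1 ha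
    intro h
    apply hk
    have := congrArg (fun q => Polynomial.coeff q (k : ℕ)) h
    simpa [p, Polynomial.finsetSum_coeff, Polynomial.coeff_monomial, Fin.val_inj] using this
  have hfin : {x | p.IsRoot x}.Finite := Polynomial.finite_setOfPred_isRoot hp
  have := hfin.measure_zero μ
  rw [ae_iff]
  convert! this using 2
  ext x
  simp [p, Polynomial.IsRoot, Polynomial.eval_finsetSum, Polynomial.eval_monomial]

lemma setInt_iff (μ : Measure ℝ) [IsFiniteMeasure μ] (g : ℝ → ℝ) (hg : Integrable g μ) :
    (∀ S : {S : Set ℝ // MeasurableSet S}, ∫ x in S.1, g x ∂μ ∈ Icc 0 (μ.real S.1)) ↔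
      ∀ᵐ x ∂μ, 0 ≤ g x ∧ g x ≤ 1 := by
  constructor
  · intro h
    have h1 : 0 ≤ᵐ[μ] g := ae_nonneg_of_forall_setIntegral_nonneg hg
      fun S hS _ => (h ⟨S, hS⟩).1
    have h2 : g ≤ᵐ[μ] fun _ => (1 : ℝ) := ae_le_of_forall_setIntegral_le hg (integrable_const _)
      fun S hS _ => by simpa using (h ⟨S, hS⟩).2
    filter_upwards [h1, h2] with x a b using ⟨a, b⟩
  · intro h S
    constructor
    · exact setIntegral_nonneg_of_ae (h.mono fun x hx => hx.1)
    · have := setIntegral_mono_ae (s := S.1) hg.integrableOn (integrable_const (1 : ℝ)).integrableOn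
        (h.mono fun x hx => hx.2)
      simpa using this

lemma lyap_L2 (μ : Measure ℝ) [IsFiniteMeasure μ] [NullSingletonClass μ] (T : ℝ)
    (hT : ∀ᵐ x ∂μ, x ∈ Icc 0 T) {n : ℕ} (f : Fin n → Lp ℝ 2 μ) (c : ℝ) (hc : c ∈ Icc (0 : ℝ) 1) :
    ∃ S, MeasurableSet S ∧ ∀ i, ∫ x in S, f i x ∂μ = c * ∫ x, f i x ∂μ := by
  classical
  let v : {S : Set ℝ // MeasurableSet S} ⊕ Fin n → Lp ℝ 2 μ :=
    Sum.elim (fun S => indicatorConstLp 2 S.2 (measure_ne_top μ _) (1 : ℝ)) f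
  let a : {S : Set ℝ // MeasurableSet S} ⊕ Fin n → ℝ :=
    Sum.elim (fun S => 0) (fun i => c * ∫ x, f i x ∂μ)
  let b : {S : Set ℝ // MeasurableSet S} ⊕ Fin n → ℝ :=
    Sum.elim (fun S => μ.real S.1) (fun i => c * ∫ x, f i x ∂μ)
  have hint : ∀ g : Lp ℝ 2 μ, Integrable g μ := fun g =>
    (Lp.memLp g).integrable (by norm_num)
  have key : ∀ g : Lp ℝ 2 μ, (∀ i, inner ℝ (v i) g ∈ Icc (a i) (b i)) ↔
      (∀ᵐ x ∂μ, 0 ≤ g x ∧ g x ≤ 1) ∧ ∀ i, ∫ x, f i x * g x ∂μ = c * ∫ x, f i x ∂μ := by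
    intro g
    rw [Sum.forall, ← setInt_iff μ g (hint g)]
    simp only [v, a, b, Sum.elim_inl, Sum.elim_inr, Icc_self, mem_singleton_iff,
      L2.inner_indicatorConstLp_one]
    simp only [L2.inner_def, RCLike.inner_apply, conj_trivial, mul_comm]
  have hone : ∀ᵐ x ∂μ, (c • indicatorConstLp 2 MeasurableSet.univ (measure_ne_top μ _) (1 : ℝ) :
      Lp ℝ 2 μ) x = c := by
    filter_upwards [Lp.coeFn_smul c (indicatorConstLp 2 MeasurableSet.univ (measure_ne_top μ _)
      (1 : ℝ) : Lp ℝ 2 μ), indicatorConstLp_coeFn (p := 2) (hs := MeasurableSet.univ)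
      (hμs := measure_ne_top μ _) (c := (1 : ℝ))] with x h1 h2
    rw [h1, Pi.smul_apply, h2]; simp
  obtain ⟨g, hg, hext⟩ := hilbert_extreme v a b
    (‖(indicatorConstLp 2 MeasurableSet.univ (measure_ne_top μ _) (1 : ℝ) : Lp ℝ 2 μ)‖)
    ⟨c • indicatorConstLp 2 MeasurableSet.univ (measure_ne_top μ _) (1 : ℝ), by
      rw [key]
      refine ⟨hone.mono fun x hx => by rw [hx]; exact hc, fun i => ?_⟩
      rw [integral_congr_ae (g := fun x => f i x * c) (hone.mono fun x hx => by simp only [hx]),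
        integral_mul_const, mul_comm]⟩
    (by
      intro g hg
      rw [key] at hg
      refine Lp.norm_le_norm_of_ae_le ?_
      filter_upwards [hg.1, indicatorConstLp_coeFn (p := 2) (hs := MeasurableSet.univ)
        (hμs := measure_ne_top μ _) (c := (1 : ℝ))] with x hx h2
      rw [h2]; simp [abs_of_nonneg hx.1, hx.2])
  simp only [key] at hg hext
  obtain ⟨hg01, hgf⟩ := hg
  have hgm : Measurable g := (Lp.stronglyMeasurable g).measurable
  have hE : ∀ ε > (0 : ℝ), μ {x | x ∈ Icc 0 T ∧ ε ≤ g x ∧ g x ≤ 1 - ε} = 0 := by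
    intro ε hε
    set E := {x | x ∈ Icc 0 T ∧ ε ≤ g x ∧ g x ≤ 1 - ε} with hEdef
    have hEm : MeasurableSet E := measurableSet_Icc.inter
      ((measurableSet_le measurable_const hgm).inter (measurableSet_le hgm measurable_const))
    obtain ⟨r, hr0, hr⟩ := exists_poly (n := n) (fun k i => ∫ x in E, x ^ (k : ℕ) * f i x ∂μ)
    let q : ℝ → ℝ := fun x => ∑ k, r k * x ^ (k : ℕ)
    have hqc : Continuous q := by fun_prop
    obtain ⟨M, hM⟩ := (isCompact_Icc (a := (0 : ℝ)) (b := T)).exists_bound_of_continuousOn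
      hqc.continuousOn
    let δ : ℝ := ε / (|M| + 1)
    have hδ : 0 < δ := by positivity
    have hδM : ∀ x ∈ E, |δ * q x| ≤ ε := by
      intro x hx
      have h1 : |q x| ≤ |M| + 1 := by
        have := hM x hx.1
        rw [Real.norm_eq_abs] at this
        linarith [le_abs_self M]
      rw [abs_mul, abs_of_pos hδ]
      calc δ * |q x| ≤ δ * (|M| + 1) := by gcongr
        _ = ε := by simp only [δ]; field_simp
    let h0 : ℝ → ℝ := E.indicator fun x => δ * q x
    have h0m : Measurable h0 := (hqc.measurable.const_mul δ).indicator hEm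
    have h0b : ∀ x, ‖h0 x‖ ≤ ε := by
      intro x
      by_cases hx : x ∈ E
      · simpa [h0, hx] using hδM x hx
      · simp [h0, hx, hε.le]
    have h0L : MemLp h0 2 μ := MemLp.of_bound h0m.aestronglyMeasurable ε (.of_forall h0b)
    let h : Lp ℝ 2 μ := h0L.toLp h0
    have hh : h =ᵐ[μ] h0 := h0L.coeFn_toLp
    have hfi : ∀ i, Integrable (fun x => f i x * h0 x) μ := fun i =>
      (hint (f i)).mul_bdd (c := ε) h0m.aestronglyMeasurable (.of_forall h0b)
    have hfg : ∀ i, Integrable (fun x => f i x * g x) μ := fun i =>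
      (hint (f i)).mul_bdd (c := 1) hgm.aestronglyMeasurable (hg01.mono fun x hx => by
        rw [Real.norm_eq_abs, abs_of_nonneg hx.1]; exact hx.2)
    have hzero : ∀ i, ∫ x, f i x * h0 x ∂μ = 0 := by
      intro i
      have e1 : (fun x => f i x * h0 x) = E.indicator
          fun x => ∑ k, δ * r k * (x ^ (k : ℕ) * f i x) := by
        ext x
        by_cases hx : x ∈ E
        · simp only [h0, q, indicator_of_mem hx, Finset.mul_sum]
          exact Finset.sum_congr rfl fun k _ => by ring
        · simp [h0, hx]
      rw [e1, integral_indicator hEm, integral_finsetSum]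
      · simp only [integral_const_mul, mul_assoc]
        rw [← Finset.mul_sum, hr i, mul_zero]
      · intro k _
        refine Integrable.const_mul ?_ _
        refine (hint (f i)).integrableOn.bdd_mul (c := |T| ^ (k : ℕ))
          (by fun_prop) ?_
        refine (ae_restrict_mem hEm).mono fun x hx => ?_
        rw [norm_pow]
        gcongr
        rw [Real.norm_eq_abs]
        exact abs_le_abs_of_nonneg hx.1.1 hx.1.2
    have hzz := hext h ?_ ?_
    · have h2 : h0 =ᵐ[μ] 0 := by
        have : h =ᵐ[μ] 0 := by rw [hzz]; exact Lp.coeFn_zero _ _ _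
        exact hh.symm.trans this
      have h3 := poly_null μ r hr0
      have h4 : ∀ᵐ x ∂μ, x ∉ E := by
        filter_upwards [h2, h3] with x hx hx2 hxE
        simp only [h0, indicator_of_mem hxE, Pi.zero_apply] at hx
        rcases mul_eq_zero.1 hx with h | h
        · exact hδ.ne' h
        · exact hx2 h
      simpa [ae_iff] using h4
    · constructor
      · filter_upwards [hg01, hh, Lp.coeFn_add g h] with x hx e1 e2
        rw [e2, Pi.add_apply, e1]
        by_cases hxE : x ∈ E
        · have := abs_le.1 (hδM x hxE)
          simp only [h0, indicator_of_mem hxE]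
          constructor <;> linarith [hxE.2.1, hxE.2.2]
        · simpa [h0, hxE] using hx
      · intro i
        rw [integral_congr_ae (g := fun x => f i x * g x + f i x * h0 x), 
          integral_add (hfg i) (hfi i), hzero, hgf, add_zero]
        filter_upwards [hh, Lp.coeFn_add g h] with x e1 e2
        rw [e2, Pi.add_apply, e1]; ring
    · constructor
      · filter_upwards [hg01, hh, Lp.coeFn_sub g h] with x hx e1 e2
        rw [e2, Pi.sub_apply, e1]
        by_cases hxE : x ∈ E
        · have := abs_le.1 (hδM x hxE)
          simp only [h0, indicator_of_mem hxE]
          constructor <;> linarith [hxE.2.1, hxE.2.2]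
        · simpa [h0, hxE] using hx
      · intro i
        rw [integral_congr_ae (g := fun x => f i x * g x - f i x * h0 x), 
          integral_sub (hfg i) (hfi i), hzero, hgf, sub_zero]
        filter_upwards [hh, Lp.coeFn_sub g h] with x e1 e2
        rw [e2, Pi.sub_apply, e1]; ring
  have h01 : ∀ᵐ x ∂μ, g x = 0 ∨ g x = 1 := by
    have : ∀ k : ℕ, ∀ᵐ x ∂μ, ¬ (x ∈ Icc 0 T ∧ 1 / ((k : ℝ) + 1) ≤ g x ∧ g x ≤ 1 - 1 / ((k : ℝ) + 1)) := by
      intro k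
      simpa [ae_iff, and_assoc] using hE (1 / ((k : ℝ) + 1)) (by positivity)
    filter_upwards [ae_all_iff.2 this, hT, hg01] with x h1 h2 h3
    by_contra hcon
    push Not at hcon
    have p0 : 0 < g x := lt_of_le_of_ne h3.1 (Ne.symm hcon.1)
    have p1 : 0 < 1 - g x := sub_pos.2 (lt_of_le_of_ne h3.2 hcon.2)
    obtain ⟨k, hk⟩ := exists_nat_one_div_lt (lt_min p0 p1)
    have := lt_min_iff.1 hk
    exact h1 k ⟨h2, this.1.le, by linarith [this.2]⟩
  refine ⟨{x | g x = 1}, measurableSet_eq_fun hgm measurable_const, fun i => ?_⟩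
  rw [← hgf i, ← integral_indicator (measurableSet_eq_fun hgm measurable_const)]
  refine integral_congr_ae ?_
  filter_upwards [h01] with x hx
  rcases hx with hx | hx <;> simp [indicator, hx]

lemma lyap (t : ℝ) {n : ℕ} (f : ℝ → Fin n → ℝ)
    (hf : Integrable f (volume.restrict (Ioc 0 t))) (c : ℝ) (hc : c ∈ Icc (0 : ℝ) 1) :
    ∃ S, MeasurableSet S ∧ ∫ x in S, f x ∂(volume.restrict (Ioc 0 t)) =
      c • ∫ x, f x ∂(volume.restrict (Ioc 0 t)) := by
  set μ := volume.restrict (Ioc (0 : ℝ) t) with hμ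
  let F : ℝ → Fin n → ℝ := hf.1.mk f
  have hF : Measurable F := hf.1.stronglyMeasurable_mk.measurable
  have hfF : f =ᵐ[μ] F := hf.1.ae_eq_mk
  have hFi : Integrable F μ := hf.congr hfF
  let w : ℝ → NNReal := fun x => 1 + ‖F x‖₊
  have hw : Measurable w := measurable_const.add hF.nnnorm
  let ν := μ.withDensity fun x => (w x : ENNReal)
  have hνμ : ν ≪ μ := withDensity_absolutelyContinuous _ _
  have : IsFiniteMeasure ν := by
    refine isFiniteMeasure_withDensity ?_
    have h1 := (integrable_const (μ := μ) (1 : ℝ)).add hFi.norm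
    have h2 := h1.lintegral_lt_top
    refine ne_of_lt (lt_of_eq_of_lt ?_ h2)
    refine lintegral_congr fun x => ?_
    simp only [w, Pi.add_apply]
    rw [ENNReal.ofReal_add (by norm_num) (norm_nonneg _)]
    simp [enorm_eq_nnnorm]
  have : NullSingletonClass ν := ⟨fun x => hνμ (measure_singleton x)⟩
  have hT : ∀ᵐ x ∂ν, x ∈ Icc 0 t := by
    refine hνμ.ae_le ?_
    exact (ae_restrict_mem measurableSet_Ioc).mono fun x hx => ⟨hx.1.le, hx.2⟩
  have hb : ∀ i, MemLp (fun x => F x i / w x) 2 ν := by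
    intro i
    refine MemLp.of_bound (Measurable.aestronglyMeasurable ?_) 1 (.of_forall fun x => ?_)
    · exact (measurable_pi_iff.1 hF i).div hw.coe_nnreal_real
    · have h1 := norm_le_pi_norm (F x) i
      have h2 : (0 : ℝ) < w x := by simp only [w]; positivity
      rw [norm_div, Real.norm_of_nonneg h2.le, div_le_one h2]
      simp only [w]; push_cast; linarith
  obtain ⟨S, hS, hSi⟩ := lyap_L2 ν t hT (fun i => (hb i).toLp _) c hc
  refine ⟨S, hS, ?_⟩
  have hsm : ∀ i x, w x • (F x i / w x) = F x i := by
    intro i x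
    have h2 : (w x : ℝ) ≠ 0 := by simp only [w]; positivity
    rw [NNReal.smul_def, smul_eq_mul]; field_simp
  have e1 : ∀ i, ∫ x in S, F x i ∂μ = c * ∫ x, F x i ∂μ := by
    intro i
    have := hSi i
    rw [integral_congr_ae (hb i).coeFn_toLp,
      integral_congr_ae (ae_restrict_of_ae (hb i).coeFn_toLp)] at this
    simp only [ν] at this
    rw [restrict_withDensity hS, integral_withDensity_eq_integral_smul hw,
      integral_withDensity_eq_integral_smul hw] at this
    simpa only [hsm] using this
  rw [integral_congr_ae hfF, integral_congr_ae (ae_restrict_of_ae hfF)]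
  ext i
  rw [Pi.smul_apply, eval_integral (fun i => hFi.eval i),
    eval_integral (fun i => hFi.integrableOn.eval i), smul_eq_mul, e1]

lemma gamma_ratio (α : ℝ) (hα0 : 0 < α) (y : ℝ) (hy : 1 < y) :
    (y - 1) ^ α * Real.Gamma y ≤ Real.Gamma (y + α) := by
  have h := Real.Gamma_mul_add_mul_le_rpow_Gamma_mul_rpow_Gamma (s := y - 1) (t := y + α)
    (a := α / (1 + α)) (b := 1 / (1 + α)) (by linarith) (by linarith) (by positivity)
    (by positivity) (by field_simp; ring)
  have e : α / (1 + α) * (y - 1) + 1 / (1 + α) * (y + α) = y := by field_simp; ring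
  rw [e] at h
  have hG : Real.Gamma y = (y - 1) * Real.Gamma (y - 1) := by
    have := Real.Gamma_add_one (s := y - 1) (by linarith)
    simpa using this
  have p1 : 0 < Real.Gamma (y - 1) := Real.Gamma_pos_of_pos (by linarith)
  have p2 : 0 < Real.Gamma (y + α) := Real.Gamma_pos_of_pos (by linarith)
  have p3 : 0 < Real.Gamma y := Real.Gamma_pos_of_pos (by linarith)
  have h2 := Real.rpow_le_rpow p3.le h (by positivity : 0 ≤ 1 + α)
  rw [Real.mul_rpow (by positivity) (by positivity), ← Real.rpow_mul p1.le, ← Real.rpow_mul p2.le,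
    div_mul_cancel₀ _ (by positivity), div_mul_cancel₀ _ (by positivity), Real.rpow_one,
    Real.rpow_add p3, Real.rpow_one] at h2
  have p4 : 0 < Real.Gamma (y - 1) ^ α := by positivity
  have h3 : Real.Gamma y ^ α = (y - 1) ^ α * Real.Gamma (y - 1) ^ α := by
    rw [hG, Real.mul_rpow (by linarith) p1.le]
  rw [h3] at h2
  have : Real.Gamma (y - 1) ^ α * ((y - 1) ^ α * Real.Gamma y) ≤
      Real.Gamma (y - 1) ^ α * Real.Gamma (y + α) := by linarith
  exact le_of_mul_le_mul_left this p4

lemma summable_ml (α : ℝ) (hα0 : 0 < α) (x : ℝ) (hx : 0 < x) :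
    Summable fun k : ℕ => x ^ k / Real.Gamma ((k + 1) * α) := by
  have hG : ∀ k : ℕ, 0 < Real.Gamma (((k : ℝ) + 1) * α) := fun k =>
    Real.Gamma_pos_of_pos (by positivity)
  have ht : Filter.Tendsto (fun k : ℕ => (((k : ℝ) + 1) * α - 1) ^ α) Filter.atTop Filter.atTop := by
    refine (tendsto_rpow_atTop hα0).comp ?_
    refine Filter.tendsto_atTop_add_const_right _ _ ?_
    refine Filter.Tendsto.atTop_mul_const hα0 ?_
    exact Filter.tendsto_atTop_add_const_right _ _ tendsto_natCast_atTop_atTop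
  have ht2 : Filter.Tendsto (fun k : ℕ => (((k : ℝ) + 1) * α)) Filter.atTop Filter.atTop := by
    refine Filter.Tendsto.atTop_mul_const hα0 ?_
    exact Filter.tendsto_atTop_add_const_right _ _ tendsto_natCast_atTop_atTop
  refine summable_of_ratio_norm_eventually_le (r := 1/2) (by norm_num) ?_
  filter_upwards [ht.eventually_ge_atTop (2 * x), ht2.eventually_gt_atTop 1] with k h1 h2
  have h3 := gamma_ratio α hα0 _ h2
  have e : ((k : ℝ) + 1) * α + α = (((k + 1 : ℕ) : ℝ) + 1) * α := by push_cast; ring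
  rw [e] at h3
  rw [Real.norm_of_nonneg (div_nonneg (by positivity) (hG _).le),
    Real.norm_of_nonneg (div_nonneg (by positivity) (hG _).le), ← mul_div_assoc,
    div_le_div_iff₀ (hG _) (hG _), pow_succ]
  have h4 : 2 * x * Real.Gamma (((k : ℝ) + 1) * α) ≤ Real.Gamma ((((k + 1 : ℕ) : ℝ) + 1) * α) :=
    (mul_le_mul_of_nonneg_right h1 (hG k).le).trans h3
  have : x ^ k * (2 * x * Real.Gamma (((k : ℝ) + 1) * α)) ≤
      x ^ k * Real.Gamma ((((k + 1 : ℕ) : ℝ) + 1) * α) := by gcongr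
  linarith

lemma pow_entry {n : ℕ} (A : Matrix (Fin n) (Fin n) ℝ) :
    ∃ m : ℝ, 0 < m ∧ ∀ k i j, |(A ^ k) i j| ≤ m ^ k := by
  refine ⟨1 + ∑ i, ∑ j, |A i j|, by positivity, fun k => ?_⟩
  set m := 1 + ∑ i, ∑ j, |A i j| with hm
  have hm0 : 0 < m := by positivity
  induction k with
  | zero =>
    intro i j
    rw [pow_zero, pow_zero, Matrix.one_apply]
    split_ifs <;> simp
  | succ k ih =>
    intro i j
    rw [pow_succ, Matrix.mul_apply, pow_succ]
    calc |∑ l, (A ^ k) i l * A l j| ≤ ∑ l, |(A ^ k) i l * A l j| := Finset.abs_sum_le_sum_abs _ _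
      _ ≤ ∑ l, m ^ k * ∑ j, |A l j| := by
        refine Finset.sum_le_sum fun l _ => ?_
        rw [abs_mul]
        exact mul_le_mul (ih i l) (Finset.single_le_sum (f := fun j => |A l j|)
          (fun _ _ => abs_nonneg _) (Finset.mem_univ j)) (abs_nonneg _) (by positivity)
      _ = m ^ k * ∑ l, ∑ j, |A l j| := by rw [Finset.mul_sum]
      _ ≤ m ^ k * m := by gcongr; linarith

/-- Entries of the series: measurable and dominated by `s^(α-1)`. -/
lemma alphaExp_entry {n : ℕ} (α : ℝ) (hα0 : 0 < α) (A : Matrix (Fin n) (Fin n) ℝ) (t : ℝ)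
    (ht : 0 < t) : ∃ C : ℝ, ∀ i j, ∃ φ : ℝ → ℝ, Measurable φ ∧
      (∀ s, 0 < s → s ≤ t → |φ s| ≤ C) ∧
      ∀ s, 0 < s → s ≤ t → alphaExp α A s i j = s ^ (α - 1) * φ s := by
  obtain ⟨m, hm0, hm⟩ := pow_entry A
  have hG : ∀ k : ℕ, 0 < Real.Gamma (((k : ℝ) + 1) * α) := fun k =>
    Real.Gamma_pos_of_pos (by positivity)
  have hsum := summable_ml α hα0 (t ^ α * m) (by positivity)
  have hb : ∀ i j (k : ℕ) s, 0 < s → s ≤ t →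
      ‖(s ^ (α * k) / Real.Gamma ((k + 1) * α)) * (A ^ k) i j‖ ≤
        (t ^ α * m) ^ k / Real.Gamma ((k + 1) * α) := by
    intro i j k s hs hst
    rw [norm_mul, Real.norm_of_nonneg (div_nonneg (by positivity) (hG _).le), mul_pow,
      ← Real.rpow_natCast (t ^ α), ← Real.rpow_mul ht.le, Real.norm_eq_abs, div_mul_eq_mul_div]
    have := hG k
    gcongr
    exact hm k i j
  refine ⟨∑' k : ℕ, (t ^ α * m) ^ k / Real.Gamma ((k + 1) * α), fun i j =>
    ⟨fun s => ∑' k : ℕ, (s ^ (α * k) / Real.Gamma ((k + 1) * α)) * (A ^ k) i j, ?_, ?_, ?_⟩⟩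
  · refine Measurable.tsum fun k => ?_
    fun_prop
  · intro s hs hst
    exact tsum_of_norm_bounded hsum.hasSum fun k => hb i j k s hs hst
  · intro s hs hst
    have hS : Summable fun k : ℕ => (s ^ (α * k) / Real.Gamma ((k + 1) * α)) • A ^ k := by
      refine Pi.summable.2 fun i => Pi.summable.2 fun j => ?_
      exact Summable.of_norm_bounded hsum fun k => by simpa using hb i j k s hs hst
    unfold alphaExp
    rw [Matrix.smul_apply, smul_eq_mul]
    congr 1
    have h1 : (∑' k : ℕ, (s ^ (α * k) / Real.Gamma ((k + 1) * α)) • A ^ k) i =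
      ∑' k : ℕ, ((s ^ (α * k) / Real.Gamma ((k + 1) * α)) • A ^ k) i := tsum_apply hS
    rw [h1, tsum_apply (Pi.summable.1 hS i)]
    rfl

lemma integrable_mv {n : ℕ} (α : ℝ) (hα0 : 0 < α) (A : Matrix (Fin n) (Fin n) ℝ) (t : ℝ)
    (ht : 0 < t) (u : ℝ → Fin n → ℝ) (hu : Measurable u) (B : ℝ) (hB : ∀ τ, ‖u τ‖ ≤ B) :
    Integrable (fun τ => (alphaExp α A (t - τ)).mulVec (u τ)) (volume.restrict (Ioc 0 t)) := by
  obtain ⟨C, hC⟩ := alphaExp_entry α hα0 A t ht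
  refine Integrable.of_eval fun i => ?_
  simp only [Matrix.mulVec, dotProduct]
  refine integrable_finsetSum _ fun j _ => ?_
  obtain ⟨φ, hφm, hφb, hφ⟩ := hC i j
  have hlt : ∀ᵐ τ ∂(volume.restrict (Ioc 0 t)), 0 < t - τ ∧ t - τ ≤ t := by
    filter_upwards [ae_restrict_mem measurableSet_Ioc,
      ae_restrict_of_ae (Measure.ae_ne volume t)] with τ h1 h2
    exact ⟨sub_pos.2 (lt_of_le_of_ne h1.2 h2), by linarith [h1.1]⟩
  have hr : Integrable (fun τ => (t - τ) ^ (α - 1)) (volume.restrict (Ioc 0 t)) := by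
    have h1 := (intervalIntegral.intervalIntegrable_rpow' (a := 0) (b := t) (r := α - 1)
      (by linarith)).comp_sub_left t
    simp only [sub_zero, sub_self] at h1
    exact h1.symm.1
  have h2 : Integrable (fun τ => (t - τ) ^ (α - 1) * (φ (t - τ) * u τ j))
      (volume.restrict (Ioc 0 t)) := by
    refine hr.mul_bdd (c := C * B) ?_ ?_
    · refine Measurable.aestronglyMeasurable ?_
      exact (hφm.comp (measurable_const.sub measurable_id)).mul (measurable_pi_iff.1 hu j)
    · filter_upwards [hlt] with τ hτ
      rw [norm_mul]
      have := hφb _ hτ.1 hτ.2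
      exact mul_le_mul this ((norm_le_pi_norm _ _).trans (hB τ)) (norm_nonneg _)
        ((abs_nonneg _).trans this)
  refine h2.congr ?_
  filter_upwards [hlt] with τ hτ
  rw [hφ _ hτ.1 hτ.2]; ring

/-- The attainability set `Z(t,z⁰)` is convex (even when `U` itself is not convex). -/
theorem stmt11 (n : ℕ) (α : ℝ) (hα0 : 0 < α) (hα1 : α < 1)
    (A : Matrix (Fin n) (Fin n) ℝ) (z0 : Fin n → ℝ)
    (U : Set (Fin n → ℝ)) (hUne : U.Nonempty) (hUcp : IsCompact U)
    (t : ℝ) (ht : 0 < t) :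
    Convex ℝ (attainSet α A z0 U t) := by
  classical
  rintro z1 ⟨u1, hu1, hU1, rfl⟩ z2 ⟨u2, hu2, hU2, rfl⟩ a b ha hb hab
  obtain ⟨B, hB⟩ := hUcp.isBounded.exists_norm_le
  have i1 := integrable_mv α hα0 A t ht u1 hu1 B fun τ => hB _ (hU1 τ)
  have i2 := integrable_mv α hα0 A t ht u2 hu2 B fun τ => hB _ (hU2 τ)
  obtain ⟨S, hS, hSi⟩ := lyap t _ (i1.sub i2) a ⟨ha, by linarith⟩
  refine ⟨fun τ => if τ ∈ S then u1 τ else u2 τ, Measurable.ite hS hu1 hu2, fun τ => ?_, ?_⟩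
  · dsimp only
    split_ifs
    exacts [hU1 τ, hU2 τ]
  rw [intervalIntegral.integral_of_le ht.le, intervalIntegral.integral_of_le ht.le,
    intervalIntegral.integral_of_le ht.le]
  have e : (fun τ => (alphaExp α A (t - τ)).mulVec (if τ ∈ S then u1 τ else u2 τ)) =
      fun τ => (alphaExp α A (t - τ)).mulVec (u2 τ) + S.indicator
        ((fun τ => (alphaExp α A (t - τ)).mulVec (u1 τ)) -
          fun τ => (alphaExp α A (t - τ)).mulVec (u2 τ)) τ := by
    ext1 τ
    by_cases h : τ ∈ S <;> simp [h]
  rw [e, integral_add i2 ((i1.sub i2).indicator hS), integral_indicator hS, hSi]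
  simp only [Pi.sub_apply]
  rw [integral_sub i1 i2]
  obtain rfl : b = 1 - a := by linarith
  module
end

section
/- Let 0 < α < 1, A a real n×n matrix, z⁰ ∈ ℝⁿ, U ⊆ ℝⁿ a nonempty compact set, and t > 0. Then the attainability set Z(t,z⁰) is a nonempty compact (closed and bounded) subset of ℝⁿ. -/
open scoped Matrix

section Helpers
open MeasureTheory Set Filter Topology


theorem isCompact_convexHull_aux {E : Type*} [NormedAddCommGroup E] [NormedSpace ℝ E]
    [FiniteDimensional ℝ E] {U : Set E} (hU : IsCompact U) (hne : U.Nonempty) :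
    IsCompact (convexHull ℝ U) := by
  obtain ⟨u0, hu0⟩ := hne
  set N := Module.finrank ℝ E + 1
  have key : convexHull ℝ U = (fun p : (Fin N → ℝ) × (Fin N → E) => ∑ i, p.1 i • p.2 i) ''
      (stdSimplex ℝ (Fin N) ×ˢ Set.pi univ (fun _ => U)) := by
    apply Subset.antisymm
    · intro x hx
      obtain ⟨ι, _, z, w, hz, hai, hw, hw1, hx⟩ := eq_pos_convex_span_of_mem_convexHull hx
      have hcard : Fintype.card ι ≤ N := by
        have := hai.card_le_finrank_succ
        exact this.trans (Nat.add_le_add_right (Submodule.finrank_le _) 1)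
      obtain ⟨e⟩ : Nonempty (ι ↪ Fin N) :=
        Function.Embedding.nonempty_of_card_le (by simpa using hcard)
      refine ⟨(Function.extend e w 0, Function.extend e z (fun _ => u0)), ⟨⟨?_, ?_⟩, ?_⟩, ?_⟩
      · intro i
        by_cases h : ∃ j, e j = i
        · obtain ⟨j, rfl⟩ := h
          simpa [e.injective.extend_apply] using (hw j).le
        · simp [Function.extend_apply' _ _ _ h]
      · rw [← hw1]
        symm
        refine Finset.sum_of_injOn e e.injective.injOn (by simp) ?_ ?_
        · intro i _ hi
          apply Function.extend_apply'
          simpa using hi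
        · intro i _
          simp [e.injective.extend_apply]
      · intro i _
        by_cases h : ∃ j, e j = i
        · obtain ⟨j, rfl⟩ := h
          simpa [e.injective.extend_apply] using hz ⟨j, rfl⟩
        · simpa [Function.extend_apply' _ _ _ h] using hu0
      · rw [← hx]
        symm
        refine Finset.sum_of_injOn e e.injective.injOn (by simp) ?_ ?_
        · intro i _ hi
          have : Function.extend e w 0 i = 0 := by
            apply Function.extend_apply'
            simpa using hi
          simp [this]
        · intro i _
          simp [e.injective.extend_apply]
    · rintro _ ⟨⟨w, z⟩, ⟨hw, hz⟩, rfl⟩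
      exact (convex_convexHull ℝ U).sum_mem (fun i _ => hw.1 i) hw.2
        (fun i _ => subset_convexHull ℝ U (hz i trivial))
  rw [key]
  refine IsCompact.image ((isCompact_stdSimplex ℝ _).prod (isCompact_univ_pi fun _ => hU)) ?_
  fun_prop

theorem selector_aux {E : Type*} [NormedAddCommGroup E] [InnerProductSpace ℝ E]
    [FiniteDimensional ℝ E] [MeasurableSpace E] [BorelSpace E] {V : Set E} (hV : IsCompact V)
    (hc : Convex ℝ V) (e : E) :
    ∃ p : V → E, Measurable p ∧ ∀ c : V, ((c : E) + p c ∈ V ∧ (c : E) - p c ∈ V) ∧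
      ∀ w, (c : E) + w ∈ V → (c : E) - w ∈ V → ‖p c - e‖ ≤ ‖w - e‖ := by
  have hWc : ∀ c : V, IsCompact {w : E | (c : E) + w ∈ V ∧ (c : E) - w ∈ V} := by
    intro c
    have h1 : IsCompact {w : E | (c : E) + w ∈ V} :=
      (Homeomorph.addLeft (c : E)).isClosedEmbedding.isCompact_preimage hV
    exact h1.inter_right (hV.isClosed.preimage (by fun_prop : Continuous fun w : E => (c : E) - w))
  have hex : ∀ c : V, ∃ p : E, ((c : E) + p ∈ V ∧ (c : E) - p ∈ V) ∧
      ∀ w, (c : E) + w ∈ V → (c : E) - w ∈ V → ‖p - e‖ ≤ ‖w - e‖ := by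
    intro c
    obtain ⟨p, hp, hmin⟩ := (hWc c).exists_isMinOn ⟨0, by simp⟩
      (by fun_prop : ContinuousOn (fun w : E => ‖w - e‖) _)
    exact ⟨p, hp, fun w h1 h2 => hmin ⟨h1, h2⟩⟩
  choose p hp hmin using hex
  refine ⟨p, ?_, fun c => ⟨hp c, hmin c⟩⟩
  obtain ⟨R, hR⟩ := hV.isBounded.exists_norm_le
  have hbd : ∀ (c : V) (w : E), (c : E) + w ∈ V → w ∈ Metric.closedBall (0 : E) (R + R) := by
    intro c w h
    have h1 := hR _ h
    have h2 := hR _ c.2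
    have : w = ((c : E) + w) - c := by abel
    rw [mem_closedBall_zero_iff, this]
    exact (norm_sub_le _ _).trans (add_le_add h1 h2)
  have hQ : ∀ D : Set E, IsClosed D →
      IsClosed {x : V × ℝ | ∃ w ∈ D, (x.1 : E) + w ∈ V ∧ (x.1 : E) - w ∈ V ∧ ‖w - e‖ ≤ x.2} := by
    intro D hD
    have : CompactSpace (Metric.closedBall (0 : E) (R + R)) :=
      isCompact_iff_compactSpace.1 (isCompact_closedBall _ _)
    have hcl : IsClosed {y : (V × ℝ) × Metric.closedBall (0 : E) (R + R) |
        ((y.2 : E) ∈ D ∧ (y.1.1 : E) + y.2 ∈ V) ∧ (y.1.1 : E) - y.2 ∈ V ∧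
          ‖(y.2 : E) - e‖ ≤ y.1.2} := by
      refine ((hD.preimage (by fun_prop)).inter (hV.isClosed.preimage (by fun_prop))).inter
        ((hV.isClosed.preimage (by fun_prop)).inter (isClosed_le
          (by fun_prop : Continuous fun y : (V × ℝ) × Metric.closedBall (0 : E) (R + R) =>
            ‖(y.2 : E) - e‖)
          (by fun_prop : Continuous fun y : (V × ℝ) × Metric.closedBall (0 : E) (R + R) =>
            y.1.2)))
    have := isClosedMap_fst_of_compactSpace _ hcl
    convert this using 1
    ext x
    constructor
    · rintro ⟨w, h1, h2, h3, h4⟩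
      exact ⟨(x, ⟨w, hbd _ _ h2⟩), ⟨⟨h1, h2⟩, h3, h4⟩, rfl⟩
    · rintro ⟨⟨x', w⟩, ⟨⟨h1, h2⟩, h3, h4⟩, rfl⟩
      exact ⟨w, h1, h2, h3, h4⟩
  have hδ : Measurable fun c : V => ‖p c - e‖ := by
    apply measurable_of_Iic
    intro r
    have : (fun c : V => ‖p c - e‖) ⁻¹' Iic r = (fun c : V => (c, r)) ⁻¹'
      {x : V × ℝ | ∃ w ∈ (univ : Set E), (x.1 : E) + w ∈ V ∧ (x.1 : E) - w ∈ V ∧ ‖w - e‖ ≤ x.2} := by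
      ext c
      constructor
      · intro h
        exact ⟨p c, trivial, (hp c).1, (hp c).2, h⟩
      · rintro ⟨w, -, h1, h2, h3⟩
        exact (hmin c w h1 h2).trans h3
    rw [this]
    exact ((hQ _ isClosed_univ).preimage (by fun_prop)).measurableSet
  apply measurable_of_isClosed
  intro D hD
  have : p ⁻¹' D = (fun c : V => (c, ‖p c - e‖)) ⁻¹'
      {x : V × ℝ | ∃ w ∈ D, (x.1 : E) + w ∈ V ∧ (x.1 : E) - w ∈ V ∧ ‖w - e‖ ≤ x.2} := by
    ext c
    constructor
    · intro h
      exact ⟨p c, h, (hp c).1, (hp c).2, le_rfl⟩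
    · rintro ⟨w, hw, h1, h2, h3⟩
      have : p c = w := by
        by_contra hne
        have h5 : (1/2 : ℝ) • p c + (1/2 : ℝ) • w ∈ Metric.ball e ‖p c - e‖ := by
          apply combo_mem_ball_of_ne _ _ hne <;> simp [dist_eq_norm] <;> try norm_num
          exact h3
        rw [mem_ball_iff_norm] at h5
        have h6 := hmin c ((1/2 : ℝ) • p c + (1/2 : ℝ) • w) ?_ ?_
        · linarith
        · convert hc (hp c).1 h1 (by norm_num : (0:ℝ) ≤ 1/2) (by norm_num : (0:ℝ) ≤ 1/2)
            (by norm_num) using 1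
          module
        · convert hc (hp c).2 h2 (by norm_num : (0:ℝ) ≤ 1/2) (by norm_num : (0:ℝ) ≤ 1/2)
            (by norm_num) using 1
          module
      rw [mem_preimage, this]; exact hw
  rw [this]
  exact (measurable_id.prodMk hδ) (hQ D hD).measurableSet

theorem not_extreme_aux {E : Type*} [AddCommGroup E] [Module ℝ E] {V : Set E} 
    (hc : Convex ℝ V) {x : E} (hx : x ∈ V) (hne : x ∉ V.extremePoints ℝ) :
    ∃ w, w ≠ 0 ∧ x + w ∈ V ∧ x - w ∈ V := by
  rw [mem_extremePoints] at hne
  push Not at hne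
  obtain ⟨a, ha, b, hb, ⟨α, β, h0, h1, h2, rfl⟩, h3⟩ := hne hx
  have hab : a ≠ b := by
    rintro rfl
    apply h3 <;> rw [← add_smul, h2, one_smul]
  have hm : 0 < min α β := lt_min h0 h1
  have hm1 := min_le_left α β
  have hm2 := min_le_right α β
  refine ⟨(min α β) • (a - b), smul_ne_zero hm.ne' (sub_ne_zero.2 hab), ?_, ?_⟩
  · convert hc ha hb (a := α + min α β) (b := β - min α β) (by linarith) (by linarith)
      (by linarith) using 1
    module
  · convert hc ha hb (a := α - min α β) (b := β + min α β) (by linarith) (by linarith)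
      (by linarith) using 1
    module

section Hilb
variable {H : Type*} [NormedAddCommGroup H] [InnerProductSpace ℝ H] [CompleteSpace H]

theorem weak_compact_aux {C : Set H} (hcl : IsClosed C) (hc : Convex ℝ C)
    (hb : Bornology.IsBounded C) :
    IsCompact {f : WeakDual ℝ H | (InnerProductSpace.toDual ℝ H).symm (WeakDual.toStrongDual f) ∈ C} := by
  obtain ⟨R, hR⟩ := hb.exists_norm_le
  refine IsCompact.of_isClosed_subset (WeakDual.isCompact_closedBall (𝕜 := ℝ) (0 : StrongDual ℝ H) R) ?_ ?_
  · have := RCLike.iInter_halfSpaces_eq' (𝕜 := ℝ) hc hcl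
    rw [← this]
    simp only [mem_iInter, mem_ofPred_eq, ofPred_forall]
    refine isClosed_iInter fun l => isClosed_iInter fun c => isClosed_iInter fun _ => ?_
    refine isClosed_le ?_ continuous_const
    have : ∀ f : WeakDual ℝ H, l ((InnerProductSpace.toDual ℝ H).symm (WeakDual.toStrongDual f))
        = f ((InnerProductSpace.toDual ℝ H).symm l) := by
      intro f
      rw [← InnerProductSpace.toDual_symm_apply (𝕜 := ℝ) (y := l), real_inner_comm,
        InnerProductSpace.toDual_symm_apply]
      rfl
    simp only [RCLike.re_to_real, this]
    exact WeakDual.eval_continuous _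
  · intro f hf
    have := hR _ hf
    simpa using this

theorem image_compact_aux {m : ℕ} {C : Set H} (hcl : IsClosed C) (hc : Convex ℝ C)
    (hb : Bornology.IsBounded C) (g : Fin m → H) :
    IsCompact ((fun (x : H) (i : Fin m) => (inner ℝ (g i) x : ℝ)) '' C) := by
  have h := (weak_compact_aux hcl hc hb).image
    (f := fun (f : WeakDual ℝ H) (i : Fin m) => f (g i))
    (continuous_pi fun i => WeakDual.eval_continuous _)
  convert h using 1
  ext z
  constructor
  · rintro ⟨x, hx, rfl⟩
    refine ⟨StrongDual.toWeakDual (InnerProductSpace.toDual ℝ H x), by simpa using hx, ?_⟩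
    ext i
    exact real_inner_comm _ _
  · rintro ⟨f, hf, rfl⟩
    refine ⟨_, hf, ?_⟩
    ext i
    simp only []
    rw [real_inner_comm, InnerProductSpace.toDual_symm_apply]
    rfl

theorem extreme_aux {C : Set H} (hcl : IsClosed C) (hc : Convex ℝ C)
    (hb : Bornology.IsBounded C) (hne : C.Nonempty) : (C.extremePoints ℝ).Nonempty := by
  obtain ⟨x, hx⟩ := hne
  have : LocallyConvexSpace ℝ (WeakDual ℝ H) :=
    inferInstanceAs (LocallyConvexSpace ℝ (WeakBilin (topDualPairing ℝ H)))
  obtain ⟨f, hf⟩ := (weak_compact_aux hcl hc hb).extremePoints_nonempty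
    ⟨StrongDual.toWeakDual (InnerProductSpace.toDual ℝ H x), by simpa using hx⟩
  let J : WeakDual ℝ H ≃ₗ[ℝ] H :=
    WeakDual.toStrongDual.trans (InnerProductSpace.toDual ℝ H).symm.toLinearEquiv
  have h := image_extremePoints (𝕜 := ℝ) J {f : WeakDual ℝ H | J f ∈ C}
  refine ⟨J f, ?_⟩
  have h2 : J '' {f : WeakDual ℝ H | J f ∈ C} = C := image_preimage_eq C J.surjective
  rw [h2] at h
  rw [← h]
  exact ⟨f, hf, rfl⟩
end Hilb

theorem aumann_aux {E : Type*} [NormedAddCommGroup E] [InnerProductSpace ℝ E]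
    [FiniteDimensional ℝ E] [MeasurableSpace E] [BorelSpace E] (μ : Measure ℝ) [IsFiniteMeasure μ]
    [NullSingletonClass μ] (t : ℝ) (hμ : ∀ᵐ τ ∂μ, τ ∈ Icc 0 t) {m : ℕ} (g : Fin m → Lp E 2 μ)
    {U : Set E} (hU : IsCompact U) (hne : U.Nonempty) :
    IsCompact {z : Fin m → ℝ | ∃ u : ℝ → E, Measurable u ∧ (∀ τ, u τ ∈ U) ∧
      z = fun i => ∫ τ, (inner ℝ (g i τ) (u τ) : ℝ) ∂μ} := by
  set V := convexHull ℝ U with hVdef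
  have hV : IsCompact V := isCompact_convexHull_aux hU hne
  have hVc : Convex ℝ V := convex_convexHull ℝ U
  have hUV : U ⊆ V := subset_convexHull ℝ U
  obtain ⟨u0, hu0⟩ := hne
  obtain ⟨R, hR⟩ := hV.isBounded.exists_norm_le
  have hR0 : 0 ≤ R := (norm_nonneg _).trans (hR _ (hUV hu0))
  let C : Set (Lp E 2 μ) := {f | ∀ᵐ τ ∂μ, f τ ∈ V}
  have hCc : Convex ℝ C := by
    intro f hf h hh a b ha hb hab
    filter_upwards [hf, hh, Lp.coeFn_add (a • f) (b • h), Lp.coeFn_smul a f, Lp.coeFn_smul b h]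
      with τ h1 h2 h3 h4 h5
    rw [h3, Pi.add_apply, h4, h5]
    exact hVc h1 h2 ha hb hab
  have hCcl : IsClosed C := by
    apply IsSeqClosed.isClosed
    intro f x hf hx
    obtain ⟨φ, -, hφ⟩ := (tendstoInMeasure_of_tendsto_Lp hx).exists_seq_tendsto_ae
    have hf' : ∀ᵐ τ ∂μ, ∀ k, f k τ ∈ V := ae_all_iff.2 hf
    filter_upwards [hφ, hf'] with τ h1 h2
    exact hV.isClosed.mem_of_tendsto h1 (Eventually.of_forall fun k => h2 _)
  have hCb : Bornology.IsBounded C := by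
    rw [isBounded_iff_forall_norm_le]
    refine ⟨_, fun f hf => Lp.norm_le_of_ae_bound hR0 (Filter.Eventually.mono (show ∀ᵐ τ ∂μ, f τ ∈ V from hf) fun τ h => hR _ h)⟩
  convert image_compact_aux hCcl hCc hCb g using 1
  have hinner : ∀ (u : ℝ → E) (f : Lp E 2 μ), f =ᵐ[μ] u → ∀ i,
      (inner ℝ (g i) f : ℝ) = ∫ τ, (inner ℝ (g i τ) (u τ) : ℝ) ∂μ := by
    intro u f h i
    rw [L2.inner_def]
    apply integral_congr_ae
    filter_upwards [h] with τ h
    rw [h]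
  apply Subset.antisymm
  · rintro _ ⟨u, hum, huU, rfl⟩
    have hmem : MemLp u 2 μ := MemLp.of_bound hum.aestronglyMeasurable R
      (Eventually.of_forall fun τ => hR _ (hUV (huU τ)))
    refine ⟨hmem.toLp u, ?_, ?_⟩
    · filter_upwards [hmem.coeFn_toLp] with τ h
      rw [h]; exact hUV (huU τ)
    · ext i
      exact hinner _ _ hmem.coeFn_toLp i
  rintro _ ⟨f0, hf0, rfl⟩
  let L : Lp E 2 μ →L[ℝ] (Fin m → ℝ) := ContinuousLinearMap.pi fun i => innerSL ℝ (g i)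
  have hL : ∀ f, L f = fun i => (inner ℝ (g i) f : ℝ) := fun f => rfl
  have hDc : Convex ℝ (C ∩ L ⁻¹' {L f0}) :=
    hCc.inter ((convex_singleton _).linear_preimage L.toLinearMap)
  have hDcl : IsClosed (C ∩ L ⁻¹' {L f0}) :=
    hCcl.inter (isClosed_singleton.preimage L.continuous)
  obtain ⟨f, hf⟩ := extreme_aux hDcl hDc (hCb.subset inter_subset_left) ⟨f0, hf0, rfl⟩
  obtain ⟨⟨hfC, hfL⟩, hext⟩ := mem_extremePoints.1 hf
  change L f0 ∈ _
  rw [← show L f = L f0 from hfL]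
  -- measurable representative
  obtain ⟨u, hum, huV, hfu⟩ : ∃ u : ℝ → E, Measurable u ∧ (∀ τ, u τ ∈ V) ∧ f =ᵐ[μ] u := by
    have hm := (Lp.stronglyMeasurable f).measurable
    classical
    refine ⟨fun τ => if f τ ∈ V then f τ else u0, Measurable.ite (hm hV.measurableSet) hm
      measurable_const, fun τ => ?_, ?_⟩
    · dsimp only
      split_ifs with h
      · exact h
      · exact hUV hu0
    · filter_upwards [show ∀ᵐ τ ∂μ, f τ ∈ V from hfC] with τ h
      simp [h]
  let u' : ℝ → V := fun τ => ⟨u τ, huV τ⟩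
  have hu' : Measurable u' := hum.subtype_mk
  have claim : ∀ p : V → E, Measurable p → (∀ c : V, (c : E) + p c ∈ V ∧ (c : E) - p c ∈ V) →
      ∀ᵐ τ ∂μ, p (u' τ) = 0 := by
    intro p hpm hp
    have hpb : ∀ c, ‖p c‖ ≤ R := by
      intro c
      have h1 := hR _ (hp c).1
      have h2 := hR _ (hp c).2
      have h3 : p c = (1/2 : ℝ) • (((c : E) + p c) - ((c : E) - p c)) := by module
      rw [h3, norm_smul]
      have := norm_sub_le ((c : E) + p c) ((c : E) - p c)
      rw [Real.norm_of_nonneg (by norm_num : (0:ℝ) ≤ 1/2)]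
      linarith
    have hqb : ∀ q : Polynomial ℝ, ∃ M, 0 ≤ M ∧ ∀ τ ∈ Icc (0:ℝ) t, ‖q.eval τ‖ ≤ M := by
      intro q
      obtain ⟨M, hM⟩ := isCompact_Icc.exists_bound_of_continuousOn (s := Icc (0:ℝ) t)
        q.continuous.continuousOn
      exact ⟨max M 0, le_max_right _ _, fun τ h => (hM τ h).trans (le_max_left _ _)⟩
    have hmem : ∀ q : Polynomial ℝ, MemLp (fun τ => q.eval τ • p (u' τ)) 2 μ := by
      intro q
      obtain ⟨M, hM0, hM⟩ := hqb q
      refine MemLp.of_bound ((q.continuous.measurable.smul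
        (hpm.comp hu')).aestronglyMeasurable) (M * R) ?_
      filter_upwards [hμ] with τ h
      rw [norm_smul]
      exact mul_le_mul (hM τ h) (hpb _) (norm_nonneg _) hM0
    let Φ : Polynomial ℝ →ₗ[ℝ] Lp E 2 μ :=
      { toFun := fun q => (hmem q).toLp
        map_add' := fun q r => by
          rw [← MemLp.toLp_add]
          apply MemLp.toLp_congr
          refine Eventually.of_forall fun τ => ?_
          simp [add_smul]
        map_smul' := fun a q => by
          rw [RingHom.id_apply, ← MemLp.toLp_const_smul]
          apply MemLp.toLp_congr
          refine Eventually.of_forall fun τ => ?_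
          simp [mul_smul] }
    have hΦ : ∀ q, (Φ q : ℝ → E) =ᵐ[μ] fun τ => q.eval τ • p (u' τ) :=
      fun q => (hmem q).coeFn_toLp
    obtain ⟨q, hq0, hq⟩ : ∃ q, q ≠ 0 ∧ L (Φ q) = 0 := by
      by_contra hcon
      push Not at hcon
      have hinj : Function.Injective (L.toLinearMap ∘ₗ Φ) := by
        rw [injective_iff_map_eq_zero]
        intro q hq
        by_contra h
        exact hcon q h hq
      exact Polynomial.not_finite (R := ℝ) (Module.Finite.of_injective _ hinj)
    obtain ⟨M, hM0, hM⟩ := hqb q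
    have hM1 : 0 < M + 1 := by linarith
    have hLh : L ((M + 1)⁻¹ • Φ q) = 0 := by rw [map_smul, hq, smul_zero]
    have hmemC : ∀ σ : ℝ, |σ| ≤ 1 → f + σ • ((M + 1)⁻¹ • Φ q) ∈ C ∩ L ⁻¹' {L f0} := by
      intro σ hσ
      constructor
      · filter_upwards [hfu, hμ, hΦ q, Lp.coeFn_add f (σ • ((M + 1)⁻¹ • Φ q)),
          Lp.coeFn_smul σ ((M + 1)⁻¹ • Φ q), Lp.coeFn_smul (M + 1)⁻¹ (Φ q)] with τ h1 h2 h3 h4 h5 h6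
        rw [h4, Pi.add_apply, h5, Pi.smul_apply, h6, Pi.smul_apply, h3, h1]
        set s := σ * ((M + 1)⁻¹ * q.eval τ) with hs
        have hs1 : |s| ≤ 1 := by
          rw [hs, abs_mul, abs_mul, abs_of_pos (inv_pos.2 hM1)]
          have h7 := hM τ h2
          rw [Real.norm_eq_abs] at h7
          have h8 : (M + 1)⁻¹ * |q.eval τ| ≤ 1 := by
            rw [inv_mul_le_iff₀ hM1]; linarith
          exact mul_le_one₀ hσ (by positivity) h8
        have h9 := abs_le.1 hs1
        convert hVc (hp (u' τ)).1 (hp (u' τ)).2 (a := (1 + s)/2) (b := (1 - s)/2) (by linarith)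
          (by linarith) (by ring) using 1
        simp only [smul_smul, ← hs]
        change u τ + s • p (u' τ) = ((1 + s)/2) • (u τ + p (u' τ)) + ((1 - s)/2) • (u τ - p (u' τ))
        module
      · show L _ = L f0
        rw [map_add, map_smul, hLh, smul_zero, add_zero]
        exact hfL
    have h1 := hext _ (hmemC 1 (by simp)) _ (hmemC (-1) (by simp)) ⟨1/2, 1/2, by norm_num,
      by norm_num, by norm_num, by module⟩
    have h2 : Φ q = 0 := by
      have h3 := h1.1
      simpa [hM1.ne'] using h3
    have h3 : ∀ᵐ τ ∂μ, q.eval τ ≠ 0 := by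
      have : {τ | q.eval τ = 0} = q.rootSet ℝ := by
        ext τ
        simp [Polynomial.mem_rootSet, hq0]
      have h4 : μ {τ | q.eval τ = 0} = 0 := by
        rw [this]
        exact (Polynomial.rootSet_finite q ℝ).measure_zero μ
      rw [ae_iff]
      simpa using h4
    have h4 := hΦ q
    rw [h2] at h4
    filter_upwards [h3, h4, Lp.coeFn_zero E 2 μ] with τ h5 h6 h7
    rw [h7] at h6
    exact (smul_eq_zero.1 h6.symm).resolve_left h5
  -- `u` takes values in `U` a.e.
  have hUae : ∀ᵐ τ ∂μ, u τ ∈ U := by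
    choose p hpm hp using fun k => selector_aux hV hVc (TopologicalSpace.denseSeq E k)
    have hall : ∀ᵐ τ ∂μ, ∀ k, p k (u' τ) = 0 :=
      ae_all_iff.2 fun k => claim (p k) (hpm k) (fun c => (hp k c).1)
    filter_upwards [hall] with τ hτ
    by_contra hnU
    have hne : u τ ∉ V.extremePoints ℝ := fun h => hnU (extremePoints_convexHull_subset h)
    obtain ⟨w, hw0, hw1, hw2⟩ := not_extreme_aux hVc (huV τ) hne
    have hwpos : 0 < ‖w‖ := norm_pos_iff.2 hw0
    obtain ⟨k, hk⟩ := (TopologicalSpace.denseRange_denseSeq E).exists_dist_lt w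
      (half_pos hwpos)
    have h1 := (hp k (u' τ)).2 w hw1 hw2
    rw [hτ k, zero_sub, norm_neg] at h1
    rw [dist_eq_norm] at hk
    have h2 := norm_add_le (w - TopologicalSpace.denseSeq E k) (TopologicalSpace.denseSeq E k)
    rw [sub_add_cancel] at h2
    linarith
  classical
  refine ⟨fun τ => if u τ ∈ U then u τ else u0, Measurable.ite (hum hU.measurableSet) hum
      measurable_const, fun τ => ?_, ?_⟩
  · dsimp only
    split_ifs with h
    · exact h
    · exact hu0
  · ext i
    refine hinner _ f ?_ i
    filter_upwards [hfu, hUae] with τ h1 h2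
    simp [h1, h2]

theorem gamma_lower_aux {x N : ℝ} (hx : 1 ≤ x) (hN : 0 < N) :
    Real.exp (-N) * N ^ (x - 1) ≤ Real.Gamma x := by
  rw [Real.Gamma_eq_integral (by linarith)]
  have hint := Real.GammaIntegral_convergent (s := x) (by linarith)
  calc Real.exp (-N) * N ^ (x - 1) = ∫ s in Ioi N, Real.exp (-s) * N ^ (x - 1) := by
        rw [integral_mul_const, integral_exp_neg_Ioi]
    _ ≤ ∫ s in Ioi N, Real.exp (-s) * s ^ (x - 1) := by
        refine setIntegral_mono_on ((integrableOn_exp_neg_Ioi N).mul_const _)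
          (hint.mono_set (Ioi_subset_Ioi hN.le)) measurableSet_Ioi ?_
        intro s hs
        have hs' : N < s := hs
        gcongr
    _ ≤ _ := by
        refine setIntegral_mono_set hint ?_ (Ioi_subset_Ioi hN.le).eventuallyLE
        filter_upwards [ae_restrict_mem measurableSet_Ioi] with s hs
        have : (0:ℝ) < s := hs
        positivity

theorem summable_aux {α t : ℝ} (hα : 0 < α) (ht : 0 ≤ t) (a : ℕ → ℝ) (b : ℝ) (hb : 0 ≤ b)
    (ha0 : ∀ k, 0 ≤ a k) (ha : ∀ k, 0 < k → a k ≤ b ^ k) :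
    Summable fun k : ℕ => t ^ (α * k) / Real.Gamma ((k + 1) * α) * a k := by
  set c := t ^ α * b with hc
  have hc0 : 0 ≤ c := by positivity
  set N : ℝ := (2 * (c + 1)) ^ (1 / α) with hN
  have hNpos : 0 < N := by positivity
  have hNα : N ^ α = 2 * (c + 1) := by
    rw [hN, ← Real.rpow_mul (by positivity), one_div_mul_cancel hα.ne', Real.rpow_one]
  have hs : Summable fun k : ℕ => (Real.exp N * N ^ (1 - α)) * (1 / 2 : ℝ) ^ k :=
    (summable_geometric_two).mul_left _
  refine Summable.of_norm_bounded_eventually_nat hs ?_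
  obtain ⟨k0, hk0⟩ := exists_nat_gt (1 / α)
  filter_upwards [eventually_ge_atTop k0, eventually_gt_atTop 0] with k hk hkpos
  have hkα : 1 ≤ ((k : ℝ) + 1) * α := by
    have : (k0 : ℝ) ≤ k := by exact_mod_cast hk
    have h1 : 1 / α ≤ (k : ℝ) + 1 := by linarith
    rwa [div_le_iff₀ hα] at h1
  have hG := gamma_lower_aux hkα hNpos
  have hGpos : 0 < Real.Gamma ((k + 1) * α) := Real.Gamma_pos_of_pos (by linarith)
  have htk : t ^ (α * k) = (t ^ α) ^ k := by rw [Real.rpow_mul ht, Real.rpow_natCast]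
  have hNk : N ^ (((k : ℝ) + 1) * α - 1) = (2 * (c + 1)) ^ k * N ^ (α - 1) := by
    rw [← hNα, ← Real.rpow_natCast (N ^ α), ← Real.rpow_mul hNpos.le, ← Real.rpow_add hNpos]
    congr 1; ring
  rw [Real.norm_of_nonneg (by have := ha0 k; positivity), htk]
  calc (t ^ α) ^ k / Real.Gamma ((k + 1) * α) * a k
      ≤ (t ^ α) ^ k / Real.Gamma ((k + 1) * α) * b ^ k := by gcongr; exact ha k hkpos
    _ = c ^ k / Real.Gamma ((k + 1) * α) := by rw [hc, mul_pow]; ring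
    _ ≤ (c + 1) ^ k / (Real.exp (-N) * N ^ (((k : ℝ) + 1) * α - 1)) := by
        gcongr; linarith
    _ = _ := by
        rw [hNk, Real.exp_neg, mul_pow, show (1 - α) = -(α - 1) by ring, Real.rpow_neg hNpos.le,
          one_div, inv_pow]
        have : 0 < N ^ (α - 1) := by positivity
        field_simp

theorem kernel_continuous_aux {n : ℕ} {α t : ℝ} (hα : 0 < α) (ht : 0 ≤ t)
    (A : Matrix (Fin n) (Fin n) ℝ) :
    ContinuousOn (fun s : ℝ => ∑' k : ℕ, (s ^ (α * k) / Real.Gamma ((k + 1) * α)) • A ^ k)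
      (Icc 0 t) := by
  let _ : NormedRing (Matrix (Fin n) (Fin n) ℝ) := Matrix.linftyOpNormedRing
  let _ : NormedAlgebra ℝ (Matrix (Fin n) (Fin n) ℝ) := Matrix.linftyOpNormedAlgebra
  have hΓ : ∀ k : ℕ, 0 < Real.Gamma (((k : ℝ) + 1) * α) := fun k =>
    Real.Gamma_pos_of_pos (by positivity)
  refine continuousOn_tsum (u := fun k : ℕ => t ^ (α * k) / Real.Gamma ((k + 1) * α) * ‖A ^ k‖)
    ?_ ?_ ?_
  · intro k
    have : Continuous fun s : ℝ => s ^ (α * k) := Real.continuous_rpow_const (by positivity)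
    exact ((this.div_const _).smul continuous_const).continuousOn
  · exact summable_aux hα ht _ ‖A‖ (norm_nonneg _) (fun k => norm_nonneg _)
      (fun k hk => norm_pow_le' A hk)
  · intro k s hs
    have h0 := hs.1
    have := hΓ k
    rw [norm_smul, Real.norm_of_nonneg (by positivity)]
    gcongr
    exact hs.2

end Helpers

open MeasureTheory Set Filter Topology

theorem stmt12 (n : ℕ) (α : ℝ) (hα0 : 0 < α) (hα1 : α < 1)
    (A : Matrix (Fin n) (Fin n) ℝ) (z0 : Fin n → ℝ)
    (U : Set (Fin n → ℝ)) (hUne : U.Nonempty) (hUcp : IsCompact U)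
    (t : ℝ) (ht : 0 < t) :
    (attainSet α A z0 U t).Nonempty ∧ IsCompact (attainSet α A z0 U t) := by
  refine ⟨?_, ?_⟩
  · obtain ⟨u0, hu0⟩ := hUne
    exact ⟨_, fun _ => u0, measurable_const, fun _ => hu0, rfl⟩
  set K : ℝ → Matrix (Fin n) (Fin n) ℝ :=
    fun s => ∑' k : ℕ, (s ^ (α * k) / Real.Gamma ((k + 1) * α)) • A ^ k with hK
  have hKc : ContinuousOn K (Icc 0 t) := kernel_continuous_aux hα0 ht.le A
  let wt : ℝ → NNReal := fun τ => Real.toNNReal ((t - τ) ^ (α - 1))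
  have hwm : Measurable wt := by
    apply Measurable.real_toNNReal
    fun_prop
  let ν : Measure ℝ := volume.restrict (Ioc 0 t)
  let μ : Measure ℝ := ν.withDensity (fun τ => (wt τ : ENNReal))
  have hac : μ ≪ ν := withDensity_absolutelyContinuous _ _
  have hIoc : ∀ᵐ τ ∂ν, τ ∈ Ioc 0 t := ae_restrict_mem measurableSet_Ioc
  have hμ : ∀ᵐ τ ∂μ, τ ∈ Icc 0 t := hac.ae_le (hIoc.mono fun τ h => ⟨h.1.le, h.2⟩)
  have hfin : IsFiniteMeasure μ := by
    have hi : IntervalIntegrable (fun τ : ℝ => (t - τ) ^ (α - 1)) volume 0 t := by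
      have h := (intervalIntegral.intervalIntegrable_rpow' (a := 0) (b := t) (r := α - 1)
        (by linarith)).comp_sub_left t (by simp)
      simpa using h.symm
    rw [intervalIntegrable_iff_integrableOn_Ioc_of_le ht.le] at hi
    exact isFiniteMeasure_withDensity_ofReal hi.2
  let row : Fin n → ℝ → EuclideanSpace ℝ (Fin n) := fun i τ => WithLp.toLp 2 (K (t - τ) i)
  have hrowc : ∀ i, ContinuousOn (row i) (Icc 0 t) := by
    intro i
    have h1 : ContinuousOn (fun τ => K (t - τ)) (Icc 0 t) :=
      hKc.comp (by fun_prop) (fun τ h => ⟨by linarith [h.2], by linarith [h.1]⟩)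
    have h2 : ContinuousOn (fun τ => K (t - τ) i) (Icc 0 t) :=
      (continuous_apply i).comp_continuousOn h1
    exact (PiLp.continuous_toLp 2 _).comp_continuousOn h2
  have hmem : ∀ i, MemLp (row i) 2 μ := by
    intro i
    obtain ⟨M, hM⟩ := isCompact_Icc.exists_bound_of_continuousOn (hrowc i)
    refine MemLp.of_bound ?_ M (hμ.mono fun τ h => hM τ h)
    exact (((hrowc i).mono Ioc_subset_Icc_self).aestronglyMeasurable measurableSet_Ioc).mono_ac hac
  have hcpt := aumann_aux μ t hμ (fun i => (hmem i).toLp (row i))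
    (hUcp.image (PiLp.continuous_toLp 2 (fun _ : Fin n => ℝ))) (hUne.image _)
  obtain ⟨R, hR⟩ := hUcp.isBounded.exists_norm_le
  -- the integral identity
  have key : ∀ u : ℝ → Fin n → ℝ, Measurable u → (∀ τ, u τ ∈ U) →
      (∫ τ in (0 : ℝ)..t, (alphaExp α A (t - τ)).mulVec (u τ)) =
      fun i => ∫ τ, (inner ℝ ((hmem i).toLp (row i) τ) (WithLp.toLp 2 (u τ)) : ℝ) ∂μ := by
    intro u hum huU
    have h1 : (∫ τ in (0 : ℝ)..t, (alphaExp α A (t - τ)).mulVec (u τ)) =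
        ∫ τ, (K (t - τ)).mulVec (u τ) ∂μ := by
      rw [intervalIntegral.integral_of_le ht.le]
      change _ = ∫ τ, (K (t - τ)).mulVec (u τ) ∂(ν.withDensity (fun τ => (wt τ : ENNReal)))
      rw [integral_withDensity_eq_integral_smul hwm]
      apply integral_congr_ae
      filter_upwards [hIoc] with τ hτ
      have h0 : 0 ≤ t - τ := by linarith [hτ.2]
      have h2 : wt τ • (K (t - τ)).mulVec (u τ) =
          ((t - τ) ^ (α - 1)) • (K (t - τ)).mulVec (u τ) := by
        rw [NNReal.smul_def, Real.coe_toNNReal _ (Real.rpow_nonneg h0 _)]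
      rw [h2, ← Matrix.smul_mulVec]
      rfl
    have hin : ∀ i τ, ((K (t - τ)).mulVec (u τ)) i =
        (inner ℝ (row i τ) (WithLp.toLp 2 (u τ)) : ℝ) := by
      intro i τ
      simp [row, Matrix.mulVec, dotProduct, PiLp.inner_apply, mul_comm]
    have humem : MemLp (fun τ => (WithLp.toLp 2 (u τ) : EuclideanSpace ℝ (Fin n))) 2 μ := by
      obtain ⟨R', hR'⟩ := (hUcp.image
        (PiLp.continuous_toLp 2 (fun _ : Fin n => ℝ))).isBounded.exists_norm_le
      refine MemLp.of_bound ?_ R' (Eventually.of_forall fun τ => hR' _ ⟨_, huU τ, rfl⟩)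
      exact ((PiLp.continuous_toLp 2 _).measurable.comp hum).aestronglyMeasurable
    have hint : ∀ i, Integrable (fun τ => ((K (t - τ)).mulVec (u τ)) i) μ := by
      intro i
      simp only [hin]
      refine (L2.integrable_inner (𝕜 := ℝ) ((hmem i).toLp (row i)) (humem.toLp _)).congr ?_
      filter_upwards [(hmem i).coeFn_toLp, humem.coeFn_toLp] with τ h2 h3
      rw [h2, h3]
    rw [h1]
    ext i
    rw [eval_integral hint]
    apply integral_congr_ae
    filter_upwards [(hmem i).coeFn_toLp] with τ h2
    rw [hin, h2]
  have himg := hcpt.image (f := fun z => (alphaExp α A t).mulVec z0 + z) (by fun_prop)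
  convert himg using 1
  ext z
  constructor
  · rintro ⟨u, hum, huU, rfl⟩
    refine ⟨_, ⟨fun τ => WithLp.toLp 2 (u τ),
      (PiLp.continuous_toLp 2 _).measurable.comp hum, fun τ => ⟨_, huU τ, rfl⟩, rfl⟩, ?_⟩
    rw [key u hum huU]
  · rintro ⟨_, ⟨v, hvm, hvU, rfl⟩, rfl⟩
    have hU2 : ∀ τ, WithLp.ofLp (v τ) ∈ U := by
      intro τ
      obtain ⟨x, hx, hxv⟩ := hvU τ
      rw [← hxv]; exact hx
    have hm2 : Measurable fun τ => WithLp.ofLp (v τ) :=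
      (PiLp.continuous_ofLp 2 _).measurable.comp hvm
    refine ⟨fun τ => WithLp.ofLp (v τ), hm2, hU2, ?_⟩
    rw [key _ hm2 hU2]
end
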